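/- Let G' = (V, A') be a two-terminal directed acyclic graph with source s and sink t in which every vertex is reachable from s, let A* ⊆ A' be given with positive capacities ν on A', and let V₁, V₂ ⊆ V be vertex sets such that G' is the parallel composition G'[V₁] ∥ G'[V₂] of the induced subgraphs. Let ϱ^{G'}, ϱ^{G'[V₁]}, ϱ^{G'[V₂]} be the label functions of G', G'[V₁], G'[V₂] (each with respect to its own source, sink, induced resetting arcs and capacities), and let n, n₁, n₂ denote their respective numbers of breakpoints. Then n ≤ n₁ + n₂ + 1. -/

import Mathlib

noncomputable section

open Finset

variable {V : Type*}

/-- The function `ϱ^a` prescribing the behavior of labels along an arc. -/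
def arcRho [DecidableEq V] (Astar : Finset (V × V)) (nu : V × V → ℝ)
    (a : V × V) (lv xa : ℝ) : ℝ :=
  if a ∈ Astar then xa / nu a else max lv (xa / nu a)

/-- Total flow on arcs of `Aset` leaving `v`. -/
def outSum [DecidableEq V] (Aset : Finset (V × V)) (x : V × V → ℝ) (v : V) : ℝ :=
  ∑ a ∈ Aset.filter (fun a => a.1 = v), x a

/-- Total flow on arcs of `Aset` entering `v`. -/
def inSum [DecidableEq V] (Aset : Finset (V × V)) (x : V × V → ℝ) (v : V) : ℝ :=
  ∑ a ∈ Aset.filter (fun a => a.2 = v), x a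

/-- `(V, Aset, Astar)` is a shortest path graph with resetting with source `s`:
`Astar ⊆ Aset`, `(V, Aset)` is acyclic, and every vertex is reachable from `s`. -/
def IsSPGR [DecidableEq V] (Aset Astar : Finset (V × V)) (s : V) : Prop :=
  Astar ⊆ Aset ∧
  (∀ v : V, ¬ Relation.TransGen (fun u w => (u, w) ∈ Aset) v v) ∧
  (∀ v : V, Relation.ReflTransGen (fun u w => (u, w) ∈ Aset) s v)

/-- `x` is a static `s`-`t` flow of value `val` on the arcs `Aset`,
with conservation required at the vertices of `Vset`. -/
def IsFlowOn [DecidableEq V] (Vset : Finset V) (Aset : Finset (V × V)) (s t : V)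
    (x : V × V → ℝ) (val : ℝ) : Prop :=
  (∀ a ∈ Aset, 0 ≤ x a) ∧
  (∀ v ∈ Vset, v ≠ s → v ≠ t → outSum Aset x v = inSum Aset x v) ∧
  outSum Aset x s - inSum Aset x s = val

/-- `x` is a normalized thin `s`-`t` flow with resetting of value `val`
with corresponding labels `l`. -/
def IsNTFOn [DecidableEq V] (Vset : Finset V) (Aset Astar : Finset (V × V)) (nu : V × V → ℝ)
    (s t : V) (x : V × V → ℝ) (val : ℝ) (l : V → ℝ) : Prop :=
  IsFlowOn Vset Aset s t x val ∧
  (∀ v ∈ Vset, 0 ≤ l v) ∧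
  (∀ w ∈ Vset, w ≠ s →
    (∀ a ∈ Aset, a.2 = w → l w ≤ arcRho Astar nu a (l a.1) (x a)) ∧
    (∃ a ∈ Aset, a.2 = w ∧ l w = arcRho Astar nu a (l a.1) (x a))) ∧
  (∀ a ∈ Aset, 0 < x a → l a.2 = arcRho Astar nu a (l a.1) (x a))

/-- Normalized thin `s`-`t` flow with resetting on the whole vertex type. -/
def IsNTF [DecidableEq V] [Fintype V] (Aset Astar : Finset (V × V)) (nu : V × V → ℝ)
    (s t : V) (x : V × V → ℝ) (val : ℝ) (l : V → ℝ) : Prop :=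
  IsNTFOn Finset.univ Aset Astar nu s t x val l

/-- `f` is affine on each member of a partition of `ℝ≥0` into `m` intervals. -/
def AffinePieces {E : Type*} [AddCommGroup E] [Module ℝ E] (f : ℝ → E) (m : ℕ) : Prop :=
  ∃ P : Finset (Set ℝ), P.card = m ∧
    ⋃₀ (↑P : Set (Set ℝ)) = Set.Ici (0 : ℝ) ∧
    ((↑P : Set (Set ℝ)).Pairwise fun I J => I ∩ J = ∅) ∧
    (∀ I ∈ P, I.OrdConnected) ∧
    (∀ I ∈ P, ∃ c d : E, ∀ q ∈ I, f q = q • c + d)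

/-- The number of breakpoints of a piecewise linear function on `ℝ≥0`:
the minimal `n` such that `ℝ≥0` can be partitioned into `n + 1` intervals
on each of which `f` is affine. -/
def breakpoints {E : Type*} [AddCommGroup E] [Module ℝ E] (f : ℝ → E) : ℕ :=
  sInf {n : ℕ | AffinePieces f (n + 1)}

/-- `(Vset, Aset)` is a two-terminal directed acyclic graph with (unique)
source `s` and (unique) sink `t`. -/
def TwoTerminal [DecidableEq V] (Vset : Finset V) (Aset : Finset (V × V)) (s t : V) : Prop :=
  s ∈ Vset ∧ t ∈ Vset ∧
  (∀ a ∈ Aset, a.1 ∈ Vset ∧ a.2 ∈ Vset) ∧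
  (∀ v : V, ¬ Relation.TransGen (fun u w => (u, w) ∈ Aset) v v) ∧
  (∀ v ∈ Vset, ((∀ a ∈ Aset, a.2 ≠ v) ↔ v = s)) ∧
  (∀ v ∈ Vset, ((∀ a ∈ Aset, a.1 ≠ v) ↔ v = t))

/-! ### Monotonicity of the labels -/

lemma arcRho_mono [DecidableEq V] {Astar : Finset (V × V)} {nu : V × V → ℝ} {a : V × V}
    (ha : 0 < nu a) {l l' x x' : ℝ} (hl : l ≤ l') (hx : x ≤ x') :
    arcRho Astar nu a l x ≤ arcRho Astar nu a l' x' := by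
  have h : x / nu a ≤ x' / nu a := by gcongr
  unfold arcRho
  split_ifs
  · exact h
  · exact max_le_max hl h

lemma arcRho_strictMono [DecidableEq V] {Astar : Finset (V × V)} {nu : V × V → ℝ} {a : V × V}
    (ha : 0 < nu a) {l l' x x' : ℝ} (hl : l < l') (hx : x < x') :
    arcRho Astar nu a l x < arcRho Astar nu a l' x' := by
  have h : x / nu a < x' / nu a := by gcongr
  unfold arcRho
  split_ifs
  · exact h
  · exact max_lt_max hl h

lemma arcRho_inter [DecidableEq V] {Astar B : Finset (V × V)} {nu : V × V → ℝ} {a : V × V}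
    (ha : a ∈ B) (l x : ℝ) : arcRho (Astar ∩ B) nu a l x = arcRho Astar nu a l x := by
  simp [arcRho, ha]

/-- The net inflow into a vertex set is the signed sum over the arcs of its cut. -/
lemma sum_inSum_sub_outSum [DecidableEq V] (S : Finset V) (A : Finset (V × V)) (x : V × V → ℝ) :
    ∑ v ∈ S, (inSum A x v - outSum A x v) =
      ∑ a ∈ A, ((if a.2 ∈ S then x a else 0) - (if a.1 ∈ S then x a else 0)) := by
  simp only [inSum, outSum, Finset.sum_filter, Finset.sum_sub_distrib]
  congr 1 <;> (rw [Finset.sum_comm]; simp)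

/-- The net inflow at the sink is the value of the flow. -/
lemma IsFlowOn.sink [DecidableEq V] {W : Finset V} {A : Finset (V × V)} {s t : V}
    {x : V × V → ℝ} {q : ℝ} (h : IsFlowOn W A s t x q) (hs : s ∈ W) (ht : t ∈ W) (hst : s ≠ t)
    (hA : ∀ a ∈ A, a.1 ∈ W ∧ a.2 ∈ W) : inSum A x t - outSum A x t = q := by
  have h0 : ∑ v ∈ W, (inSum A x v - outSum A x v) = 0 := by
    rw [sum_inSum_sub_outSum]
    refine Finset.sum_eq_zero fun a ha => ?_
    simp [hA a ha]
  rw [← Finset.add_sum_erase _ _ hs,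
    ← Finset.add_sum_erase _ _ (Finset.mem_erase.2 ⟨hst.symm, ht⟩),
    Finset.sum_eq_zero (s := (W.erase s).erase t)] at h0
  · linarith [h.2.2]
  · intro v hv
    simp only [Finset.mem_erase] at hv
    rw [h.2.1 v hv.2.2 hv.2.1 hv.1, sub_self]

/-- Labels of normalized thin flows are monotone in the flow value, and they are also
monotone in the label of the sink. -/
lemma IsNTFOn.label_le [DecidableEq V] [Finite V] {W : Finset V} {A Astar : Finset (V × V)}
    {nu : V × V → ℝ} {s t : V} (hnu : ∀ a ∈ A, 0 < nu a) (htt : TwoTerminal W A s t)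
    {x x' : V × V → ℝ} {q q' : ℝ} {l l' : V → ℝ}
    (h : IsNTFOn W A Astar nu s t x q l) (h' : IsNTFOn W A Astar nu s t x' q' l')
    (hs : l s = l' s) (hle : q ≤ q' ∨ l t ≤ l' t) : ∀ v ∈ W, l v ≤ l' v := by
  obtain ⟨hsW, htW, hAW, hac, hsrc, -⟩ := htt
  by_contra! hcon
  set S := W.filter (fun v => l' v < l v) with hS
  have memS : ∀ v ∈ W, (v ∈ S ↔ l' v < l v) := fun v hv => by simp [hS, hv]
  have hsS : s ∉ S := by rw [memS s hsW, hs]; exact lt_irrefl _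
  have net : ∑ v ∈ S, (inSum A x v - outSum A x v) ≤ ∑ v ∈ S, (inSum A x' v - outSum A x' v) := by
    refine Finset.sum_le_sum fun v hv => ?_
    have hvW : v ∈ W := (Finset.mem_filter.1 hv).1
    have hvs : v ≠ s := fun e => hsS (e ▸ hv)
    by_cases hvt : v = t
    · subst hvt
      rw [h.1.sink hsW htW hvs.symm hAW, h'.1.sink hsW htW hvs.symm hAW]
      rcases hle with hle | hle
      · exact hle
      · exact absurd ((memS v hvW).1 hv) (not_lt.2 hle)
    · rw [h.1.2.1 v hvW hvs hvt, h'.1.2.1 v hvW hvs hvt, sub_self, sub_self]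
  have enter : ∀ a ∈ A, a.1 ∉ S → a.2 ∈ S → x' a ≤ x a := by
    intro a ha h1 h2
    rw [memS _ (hAW a ha).1, not_lt] at h1
    rw [memS _ (hAW a ha).2] at h2
    by_contra! hlt
    have e1 := h'.2.2.2 a ha ((h.1.1 a ha).trans_lt hlt)
    have e2 := (h.2.2.1 a.2 (hAW a ha).2 (by rintro e; rw [e, hs] at h2; exact lt_irrefl _ h2)).1
      a ha rfl
    have e3 := arcRho_mono (Astar := Astar) (hnu a ha) h1 hlt.le
    linarith
  have leave : ∀ a ∈ A, a.1 ∈ S → a.2 ∉ S → x a ≤ x' a := by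
    intro a ha h1 h2
    rw [memS _ (hAW a ha).1] at h1
    rw [memS _ (hAW a ha).2, not_lt] at h2
    by_contra! hlt
    have e1 := h.2.2.2 a ha ((h'.1.1 a ha).trans_lt hlt)
    have e3 := arcRho_strictMono (Astar := Astar) (hnu a ha) h1 hlt
    have e2 := (h'.2.2.1 a.2 (hAW a ha).2 ((hsrc s hsW).2 rfl a ha)).1 a ha rfl
    linarith
  have term : ∀ a ∈ A, ((if a.2 ∈ S then x' a else 0) - (if a.1 ∈ S then x' a else 0)) ≤
      ((if a.2 ∈ S then x a else 0) - (if a.1 ∈ S then x a else 0)) := by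
    intro a ha
    have := enter a ha
    have := leave a ha
    split_ifs <;> simp_all
  rw [sum_inSum_sub_outSum, sum_inSum_sub_outSum] at net
  have cut := (Finset.sum_eq_sum_iff_of_le term).1 (le_antisymm (Finset.sum_le_sum term) net)
  have wf : WellFounded (Relation.TransGen fun u w => (u, w) ∈ A) := by
    have : Std.Irrefl (Relation.TransGen fun u w => (u, w) ∈ A) := ⟨hac⟩
    exact Finite.wellFounded_of_trans_of_irrefl _
  obtain ⟨v, hvW, hv⟩ := hcon
  obtain ⟨w, hw, hmin⟩ := wf.has_min {w | w ∈ S} ⟨v, (memS v hvW).2 hv⟩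
  have hwW : w ∈ W := (Finset.mem_filter.1 hw).1
  have hws : w ≠ s := fun e => hsS (e ▸ hw)
  obtain ⟨a, ha, rfl, hal⟩ := (h'.2.2.1 w hwW hws).2
  have h1 : a.1 ∉ S := fun h1 => hmin a.1 h1 (Relation.TransGen.single ha)
  have hx : x a = x' a := by simpa [h1, show a.2 ∈ S from hw] using (cut a ha).symm
  rw [memS _ (hAW a ha).1, not_lt] at h1
  have e2 := (h.2.2.1 a.2 hwW hws).1 a ha rfl
  have e3 := arcRho_mono (Astar := Astar) (hnu a ha) h1 hx.le
  have e4 := (memS _ hwW).1 hw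
  linarith

/-! ### Restriction to a part of a parallel composition -/

lemma IsNTFOn.part_labels [DecidableEq V] [Fintype V] {A Astar B : Finset (V × V)} {W : Finset V}
    {nu : V × V → ℝ} {s t : V} (hnu : ∀ a ∈ A, 0 < nu a) (hst : s ≠ t)
    (hW : TwoTerminal W B s t) (hBA : B ⊆ A)
    (hin : ∀ a ∈ A, a.2 ∈ W → a.2 ≠ s → a.2 ≠ t → a ∈ B)
    (hout : ∀ a ∈ A, a.1 ∈ W → a.1 ≠ s → a.1 ≠ t → a ∈ B)
    {r : ℝ → V → ℝ} (hr : ∀ q : ℝ, 0 ≤ q → ∃ x : V × V → ℝ,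
      IsNTFOn W B (Astar ∩ B) nu s t x q (r q) ∧ r q s = 1)
    {x : V × V → ℝ} {q : ℝ} {l : V → ℝ}
    (h : IsNTFOn Finset.univ A Astar nu s t x q l) (hls : l s = 1) :
    0 ≤ outSum B x s ∧ (∀ v ∈ W, v ≠ t → l v = r (outSum B x s) v) ∧
      l t ≤ r (outSum B x s) t ∧ (0 < outSum B x s → l t = r (outSum B x s) t) ∧
      (∀ a ∈ B, a.2 = t → l t = arcRho Astar nu a (l a.1) (x a) →
        l t = r (outSum B x s) t) := by
  have hW' := hW
  obtain ⟨hsW, htW, hBW, -, hsrc, hsink⟩ := hW'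
  have hs0 : ∀ a ∈ B, a.2 ≠ s := (hsrc s hsW).2 rfl
  have ht0 : ∀ a ∈ B, a.1 ≠ t := (hsink t htW).2 rfl
  have hx0 : ∀ a ∈ B, 0 ≤ x a := fun a ha => h.1.1 a (hBA ha)
  have hq : 0 ≤ outSum B x s :=
    Finset.sum_nonneg fun a ha => hx0 a (Finset.mem_filter.1 ha).1
  set p := outSum B x s with hp
  have hflow : IsFlowOn W B s t x p := by
    refine ⟨hx0, fun v hv hvs hvt => ?_, ?_⟩
    · have e := h.1.2.1 v (Finset.mem_univ v) hvs hvt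
      have e1 : A.filter (fun a => a.1 = v) = B.filter (fun a => a.1 = v) := by
        ext a
        simp only [Finset.mem_filter]
        constructor
        · rintro ⟨ha, rfl⟩
          exact ⟨hout a ha hv hvs hvt, rfl⟩
        · exact fun ha => ⟨hBA ha.1, ha.2⟩
      have e2 : A.filter (fun a => a.2 = v) = B.filter (fun a => a.2 = v) := by
        ext a
        simp only [Finset.mem_filter]
        constructor
        · rintro ⟨ha, rfl⟩
          exact ⟨hin a ha hv hvs hvt, rfl⟩
        · exact fun ha => ⟨hBA ha.1, ha.2⟩
      simpa [outSum, inSum, e1, e2] using e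
    · have : inSum B x s = 0 := by
        rw [inSum, Finset.filter_eq_empty_iff.2 fun a ha => hs0 a ha, Finset.sum_empty]
      rw [this, sub_zero]
  have hne : (B.filter (fun a => a.2 = t)).Nonempty := by
    by_contra hemp
    rw [Finset.not_nonempty_iff_eq_empty, Finset.filter_eq_empty_iff] at hemp
    exact hst ((hsrc t htW).1 fun a ha => hemp ha).symm
  obtain ⟨b, hb, hbmin⟩ := Finset.exists_min_image _
    (fun a => arcRho Astar nu a (l a.1) (x a)) hne
  obtain ⟨hbB, hbt⟩ := Finset.mem_filter.1 hb
  set m := arcRho Astar nu b (l b.1) (x b) with hm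
  have hmin : ∀ a ∈ B, a.2 = t → m ≤ arcRho Astar nu a (l a.1) (x a) :=
    fun a ha hat => hbmin a (Finset.mem_filter.2 ⟨ha, hat⟩)
  have hlm : l t ≤ m := (h.2.2.1 t (Finset.mem_univ _) hst.symm).1 b (hBA hbB) hbt
  have hatt : ∀ a ∈ B, a.2 = t → l t = arcRho Astar nu a (l a.1) (x a) → l t = m :=
    fun a ha hat e => le_antisymm hlm (e ▸ hmin a ha hat)
  set l1 := Function.update l t m with hl1
  have l1t : l1 t = m := by simp [hl1]
  have l1v : ∀ v, v ≠ t → l1 v = l v := fun v hv => by simp [hl1, hv]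
  have hrho : ∀ a ∈ B, arcRho (Astar ∩ B) nu a (l1 a.1) (x a) =
      arcRho Astar nu a (l a.1) (x a) := fun a ha => by
    rw [arcRho_inter ha, l1v _ (ht0 a ha)]
  have hntf : IsNTFOn W B (Astar ∩ B) nu s t x p l1 := by
    refine ⟨hflow, fun v _ => ?_, fun w hw hws => ?_, fun a ha hxa => ?_⟩
    · by_cases hv : v = t
      · rw [hv, l1t]; exact (h.2.1 t (Finset.mem_univ _)).trans hlm
      · rw [l1v v hv]; exact h.2.1 v (Finset.mem_univ _)
    · by_cases hwt : w = t
      · subst hwt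
        exact ⟨fun a ha hat => by rw [hrho a ha, l1t]; exact hmin a ha hat,
          b, hbB, hbt, by rw [hrho b hbB, l1t]⟩
      · obtain ⟨g1, a, ha, haw, g2⟩ := h.2.2.1 w (Finset.mem_univ _) hws
        have haB : a ∈ B := by subst haw; exact hin a ha hw hws hwt
        exact ⟨fun a ha haw => by rw [hrho a ha, l1v w hwt]; exact g1 a (hBA ha) haw,
          a, haB, haw, by rw [hrho a haB, l1v w hwt]; exact g2⟩
    · have e := h.2.2.2 a (hBA ha) hxa
      rw [hrho a ha, ← e]
      by_cases hat : a.2 = t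
      · rw [hat] at e ⊢
        rw [l1t]; exact (hatt a ha hat e).symm
      · rw [l1v _ hat]
  obtain ⟨y, hy, hys⟩ := hr p hq
  have hnuB : ∀ a ∈ B, 0 < nu a := fun a ha => hnu a (hBA ha)
  have hss : l1 s = r p s := by rw [l1v s hst, hls, hys]
  have heq : ∀ v ∈ W, l1 v = r p v := fun v hv => le_antisymm
    (hntf.label_le hnuB hW hy hss (Or.inl le_rfl) v hv)
    (hy.label_le hnuB hW hntf hss.symm (Or.inl le_rfl) v hv)
  have hmr : m = r p t := by rw [← l1t]; exact heq t htW
  refine ⟨hq, fun v hv hvt => by rw [← l1v v hvt]; exact heq v hv, hmr ▸ hlm, fun hpos => ?_,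
    fun a ha hat e => hmr ▸ hatt a ha hat e⟩
  have hsk := hflow.sink hsW htW hst hBW
  have hot : outSum B x t = 0 := by
    rw [outSum, Finset.filter_eq_empty_iff.2 fun a ha => ht0 a ha, Finset.sum_empty]
  rw [hot, sub_zero] at hsk
  obtain ⟨a, ha, hxa⟩ := Finset.exists_lt_of_sum_lt (f := fun _ => (0 : ℝ)) (g := x)
    (s := B.filter (fun a => a.2 = t)) (by simpa [inSum, hsk] using (hsk ▸ hpos : 0 < inSum B x t))
  obtain ⟨haB, hat⟩ := Finset.mem_filter.1 ha
  rw [← hmr]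
  exact hatt a haB hat (hat ▸ h.2.2.2 a (hBA haB) hxa)

/-! ### Partitions into intervals as monotone index functions -/

lemma AffinePieces.exists_index {E : Type*} [AddCommGroup E] [Module ℝ E] {f : ℝ → E} {m : ℕ}
    (h : AffinePieces f m) : ∃ g : ℝ → ℕ, (∀ q, 0 ≤ q → 1 ≤ g q ∧ g q ≤ m) ∧ Monotone g ∧
      ∀ k, ∃ c d : E, ∀ q, 0 ≤ q → g q = k → f q = q • c + d := by
  classical
  obtain ⟨P, rfl, hU, hdisj, hconn, haff⟩ := h
  have hcov : ∀ q : ℝ, 0 ≤ q → ∃ I ∈ P, q ∈ I := fun q hq => by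
    have : q ∈ ⋃₀ (↑P : Set (Set ℝ)) := hU ▸ hq
    simpa using this
  let M : ℝ → Finset (Set ℝ) := fun q => P.filter fun I => ∃ y ∈ I, y ≤ q
  have hM : ∀ p q, p ≤ q → M p ⊆ M q := fun p q hpq I hI => by
    obtain ⟨hIP, y, hy, hyp⟩ := Finset.mem_filter.1 hI
    exact Finset.mem_filter.2 ⟨hIP, y, hy, hyp.trans hpq⟩
  have hpiece : ∀ p q, (M p).card = (M q).card → p ≤ q → 0 ≤ p → ∀ I ∈ P, q ∈ I → p ∈ I := by
    intro p q hc hpq hp I hI hqI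
    have e := Finset.eq_of_subset_of_card_le (hM p q hpq) hc.ge
    have : I ∈ M p := e ▸ Finset.mem_filter.2 ⟨hI, q, hqI, le_rfl⟩
    obtain ⟨-, y, hy, hyp⟩ := Finset.mem_filter.1 this
    exact (hconn I hI).out hy hqI ⟨hyp, hpq⟩
  refine ⟨fun q => (M q).card, fun q hq => ⟨?_, Finset.card_filter_le _ _⟩,
    fun p q hpq => Finset.card_le_card (hM p q hpq), fun k => ?_⟩
  · obtain ⟨I, hI, hqI⟩ := hcov q hq
    exact Finset.card_pos.2 ⟨I, Finset.mem_filter.2 ⟨hI, q, hqI, le_rfl⟩⟩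
  · by_cases hk : ∃ q, 0 ≤ q ∧ (M q).card = k
    · obtain ⟨q₀, hq₀, hk₀⟩ := hk
      obtain ⟨I, hI, hq₀I⟩ := hcov q₀ hq₀
      obtain ⟨c, d, hcd⟩ := haff I hI
      refine ⟨c, d, fun q hq hqk => hcd q ?_⟩
      rcases le_total q q₀ with hle | hle
      · exact hpiece q q₀ (hqk.trans hk₀.symm) hle hq I hI hq₀I
      · obtain ⟨J, hJ, hqJ⟩ := hcov q hq
        have hq₀J := hpiece q₀ q (hk₀.trans hqk.symm) hle hq₀ J hJ hqJ
        by_cases hIJ : I = J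
        · exact hIJ ▸ hqJ
        · exact absurd (hdisj hI hJ hIJ) (Set.nonempty_iff_ne_empty.1 ⟨q₀, hq₀I, hq₀J⟩)
    · exact ⟨0, 0, fun q hq hqk => absurd ⟨q, hq, hqk⟩ hk⟩

lemma breakpoints_le_of_index {E : Type*} [AddCommGroup E] [Module ℝ E] {f : ℝ → E} {N : ℕ}
    {g : ℝ → ℕ} (hg : ∀ q, 0 ≤ q → 1 ≤ g q ∧ g q ≤ N + 1)
    (hmono : ∀ p q, 0 ≤ p → p ≤ q → g p ≤ g q)
    (haff : ∀ k, ∃ c d : E, ∀ q, 0 ≤ q → g q = k → f q = q • c + d) : breakpoints f ≤ N := by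
  classical
  let F : ℕ → Set ℝ := fun k => {q | 0 ≤ q ∧ g q = k}
  let P : Finset (Set ℝ) := ((Finset.Icc 1 (N + 1)).image F).filter Set.Nonempty
  have hcard : P.card ≤ N + 1 :=
    (Finset.card_filter_le _ _).trans (Finset.card_image_le.trans (by simp))
  have hmem : ∀ q, 0 ≤ q → F (g q) ∈ P := fun q hq =>
    Finset.mem_filter.2 ⟨Finset.mem_image.2 ⟨g q, Finset.mem_Icc.2 (hg q hq), rfl⟩, q, hq, rfl⟩
  have hform : ∀ I ∈ P, ∃ k, I = F k := fun I hI => by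
    obtain ⟨k, -, rfl⟩ := Finset.mem_image.1 (Finset.mem_filter.1 hI).1
    exact ⟨k, rfl⟩
  have hpos : 0 < P.card := Finset.card_pos.2 ⟨_, hmem 0 le_rfl⟩
  have hP : AffinePieces f (P.card - 1 + 1) := by
    refine ⟨P, by omega, ?_, fun I hI J hJ hIJ => ?_, fun I hI => ?_, fun I hI => ?_⟩
    · ext q
      constructor
      · rintro ⟨I, hI, hq⟩
        obtain ⟨k, rfl⟩ := hform I hI
        exact hq.1
      · exact fun hq => ⟨F (g q), hmem q hq, hq, rfl⟩
    · obtain ⟨k, rfl⟩ := hform I hI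
      obtain ⟨k', rfl⟩ := hform J hJ
      refine Set.eq_empty_of_forall_notMem fun q hq => hIJ ?_
      rw [← hq.1.2, ← hq.2.2]
    · obtain ⟨k, rfl⟩ := hform I hI
      refine ⟨fun p hp q hq r hr => ⟨hp.1.trans hr.1, le_antisymm ?_ ?_⟩⟩
      · rw [← hq.2]; exact hmono r q (hp.1.trans hr.1) hr.2
      · rw [← hp.2]; exact hmono p r hp.1 hr.1
    · obtain ⟨k, rfl⟩ := hform I hI
      obtain ⟨c, d, hcd⟩ := haff k
      exact ⟨c, d, fun q hq => hcd q hq.1 hq.2⟩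
  exact (Nat.sInf_le (show P.card - 1 ∈ {n | AffinePieces f (n + 1)} from hP)).trans (by omega)

/-- If `f` is determined by its monotone coordinate `t`, the pieces of `f` can be indexed
by the value of that coordinate; on each piece, `f` is constant or its coordinate `t` has
positive slope. -/
lemma exists_index_of_level {W : Finset V} {t : V} (ht : t ∈ W) {r : ℝ → V → ℝ}
    (hmono : ∀ p q, 0 ≤ p → p ≤ q → r p t ≤ r q t)
    (hdet : ∀ p q, 0 ≤ p → 0 ≤ q → r p t = r q t → ∀ v ∈ W, r p v = r q v)
    {m : ℕ} (h : AffinePieces (fun q (v : {v // v ∈ W}) => r q v.val) m) :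
    ∃ g : ℝ → ℕ, (∀ q, 0 ≤ q → 1 ≤ g (r q t) ∧ g (r q t) ≤ m) ∧
      (∀ p q, 0 ≤ p → 0 ≤ q → r p t ≤ r q t → g (r p t) ≤ g (r q t)) ∧
      ∀ k, ∃ c d : V → ℝ, (0 < c t ∨ c = 0) ∧
        ∀ q, 0 ≤ q → g (r q t) = k → ∀ v ∈ W, r q v = q * c v + d v := by
  classical
  obtain ⟨g, hg, hgm, haff⟩ := h.exists_index
  have hex : ∀ θ, ∃ k, ∀ q, 0 ≤ q → r q t = θ → ∃ y z, 0 ≤ y ∧ 0 ≤ z ∧ r y t = θ ∧ r z t = θ ∧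
      g y = k ∧ g z = k ∧ (y < z ∨ y = q) := by
    intro θ
    by_cases h2 : ∃ p q, 0 ≤ p ∧ p < q ∧ r p t = θ ∧ r q t = θ
    · obtain ⟨p, q, hp, hpq, hpθ, hqθ⟩ := h2
      have hlev : ∀ y ∈ Set.Icc p q, r y t = θ := fun y hy =>
        le_antisymm (hqθ ▸ hmono y q (hp.trans hy.1) hy.2) (hpθ ▸ hmono p y hp hy.1)
      obtain ⟨y, hy, z, hz, hyz, hgyz⟩ := (Set.Icc_infinite hpq).exists_ne_map_eq_of_mapsTo
        (t := Set.Icc 1 m) (f := g) (fun y hy => hg y (hp.trans hy.1)) (Set.finite_Icc _ _)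
      rcases lt_or_gt_of_ne hyz with hlt | hlt
      · exact ⟨g y, fun _ _ _ => ⟨y, z, hp.trans hy.1, hp.trans hz.1, hlev y hy, hlev z hz, rfl,
          hgyz.symm, Or.inl hlt⟩⟩
      · exact ⟨g y, fun _ _ _ => ⟨z, y, hp.trans hz.1, hp.trans hy.1, hlev z hz, hlev y hy,
          hgyz.symm, rfl, Or.inl hlt⟩⟩
    · by_cases h1 : ∃ p, 0 ≤ p ∧ r p t = θ
      · obtain ⟨p, hp, hpθ⟩ := h1
        refine ⟨g p, fun q hq hqθ => ⟨p, p, hp, hp, hpθ, hpθ, rfl, rfl, Or.inr ?_⟩⟩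
        by_contra hne
        rcases lt_or_gt_of_ne hne with hlt | hlt
        · exact h2 ⟨p, q, hp, hlt, hpθ, hqθ⟩
        · exact h2 ⟨q, p, hq, hlt, hqθ, hpθ⟩
      · exact ⟨0, fun q hq hqθ => absurd ⟨q, hq, hqθ⟩ h1⟩
  choose G hG using hex
  refine ⟨G, fun q hq => ?_, fun p q hp hq hpq => ?_, fun k => ?_⟩
  · obtain ⟨y, z, hy, -, -, -, hgy, -⟩ := hG (r q t) q hq rfl
    exact hgy ▸ hg y hy
  · rcases hpq.eq_or_lt with heq | hlt
    · rw [heq]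
    · obtain ⟨y, -, hy, -, hyt, -, hgy, -⟩ := hG (r p t) p hp rfl
      obtain ⟨z, -, hz, -, hzt, -, hgz, -⟩ := hG (r q t) q hq rfl
      rw [← hgy, ← hgz]
      refine hgm (le_of_lt ?_)
      by_contra! hle
      have := hmono z y hz hle
      linarith
  · by_cases hk : ∃ p q, 0 ≤ p ∧ 0 ≤ q ∧ G (r p t) = k ∧ G (r q t) = k ∧ r p t < r q t
    · obtain ⟨p, q, hp, hq, hpk, hqk, hlt⟩ := hk
      obtain ⟨c, d, hcd⟩ := haff k
      have hval : ∀ y, 0 ≤ y → g y = k → ∀ v (hv : v ∈ W), r y v = y * c ⟨v, hv⟩ + d ⟨v, hv⟩ :=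
        fun y hy hyk v hv => by simpa using congrFun (hcd y hy hyk) ⟨v, hv⟩
      obtain ⟨y, -, hy, -, hyt, -, hgy, -⟩ := hG (r p t) p hp rfl
      obtain ⟨z, -, hz, -, hzt, -, hgz, -⟩ := hG (r q t) q hq rfl
      have hyz : y < z := by
        by_contra! hle
        have := hmono z y hz hle
        linarith
      have hct : 0 < c ⟨t, ht⟩ := by
        have e1 := hval y hy (hgy.trans hpk) t ht
        have e2 := hval z hz (hgz.trans hqk) t ht
        by_contra! hc
        nlinarith
      refine ⟨fun v => if hv : v ∈ W then c ⟨v, hv⟩ else 0,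
        fun v => if hv : v ∈ W then d ⟨v, hv⟩ else 0, Or.inl (by simpa [ht] using hct),
        fun w hw hwk v hv => ?_⟩
      obtain ⟨a, b, ha, hb, hat, hbt, hga, hgb, hab⟩ := hG (r w t) w hw rfl
      rcases hab with hab | rfl
      · have e1 := hval a ha (hga.trans hwk) t ht
        have e2 := hval b hb (hgb.trans hwk) t ht
        have := mul_lt_mul_of_pos_right hab hct
        linarith
      · simpa [hv] using hval a ha (hga.trans hwk) v hv
    · by_cases hk' : ∃ p, 0 ≤ p ∧ G (r p t) = k
      · obtain ⟨p, hp, hpk⟩ := hk'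
        refine ⟨0, r p, Or.inr rfl, fun q hq hqk v hv => ?_⟩
        have : r q t = r p t := by
          by_contra hne
          rcases lt_or_gt_of_ne hne with hlt | hlt
          · exact hk ⟨q, p, hq, hp, hqk, hpk, hlt⟩
          · exact hk ⟨p, q, hp, hq, hpk, hqk, hlt⟩
        simpa using hdet q p hq hp this v hv
      · exact ⟨0, 0, Or.inr rfl, fun q hq hqk => absurd ⟨q, hq, hqk⟩ hk'⟩

/-- The labels `F` arise from the labels `r₁`, `r₂` of two parts (with vertex sets `W₁`, `W₂`
and common sink `t`) by splitting the flow value. -/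
def SplitsInto (W₁ W₂ : Finset V) (t : V) (F r₁ r₂ : ℝ → V → ℝ) : Prop :=
  ∀ q, 0 ≤ q → ∃ q₁ q₂, 0 ≤ q₁ ∧ 0 ≤ q₂ ∧ q = q₁ + q₂ ∧
    (∀ v ∈ W₁, v ≠ t → F q v = r₁ q₁ v) ∧ (∀ v ∈ W₂, v ≠ t → F q v = r₂ q₂ v) ∧
    F q t ≤ r₁ q₁ t ∧ F q t ≤ r₂ q₂ t ∧
    (0 < q₁ → F q t = r₁ q₁ t) ∧ (0 < q₂ → F q t = r₂ q₂ t) ∧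
    (F q t = r₁ q₁ t ∨ F q t = r₂ q₂ t)

lemma SplitsInto.symm {W₁ W₂ : Finset V} {t : V} {F r₁ r₂ : ℝ → V → ℝ}
    (h : SplitsInto W₁ W₂ t F r₁ r₂) : SplitsInto W₂ W₁ t F r₂ r₁ := fun q hq => by
  obtain ⟨q₁, q₂, h1, h2, h3, h4, h5, h6, h7, h8, h9, h10⟩ := h q hq
  exact ⟨q₂, q₁, h2, h1, by rw [h3, add_comm], h5, h4, h7, h6, h9, h8, h10.symm⟩

/-- The split of the flow value that balances two affine sink labels is affine. -/
lemma exists_affine_split {α γ : ℝ} (h : α + γ ≠ 0) (β δ : ℝ) :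
    ∃ k₁ e₁ k₂ e₂ : ℝ, ∀ q₁ q₂ : ℝ, q₁ * α + β = q₂ * γ + δ →
      q₁ = (q₁ + q₂) * k₁ + e₁ ∧ q₂ = (q₁ + q₂) * k₂ + e₂ := by
  refine ⟨γ / (α + γ), (δ - β) / (α + γ), α / (α + γ), (β - δ) / (α + γ), fun q₁ q₂ e => ⟨?_, ?_⟩⟩
  · field_simp
    linarith
  · field_simp
    linarith

lemma SplitsInto.breakpoints_le_of_le {W₁ W₂ : Finset V} {t : V} {F r₁ r₂ : ℝ → V → ℝ}
    (h : SplitsInto W₁ W₂ t F r₁ r₂) (hW : ∀ v, v ∈ W₁ ∨ v ∈ W₂) (ht₁ : t ∈ W₁) (ht₂ : t ∈ W₂)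
    (hF : ∀ p q, 0 ≤ p → p ≤ q → F p t ≤ F q t)
    (hmono₁ : ∀ p q, 0 ≤ p → p ≤ q → r₁ p t ≤ r₁ q t)
    (hmono₂ : ∀ p q, 0 ≤ p → p ≤ q → r₂ p t ≤ r₂ q t)
    (hdet₁ : ∀ p q, 0 ≤ p → 0 ≤ q → r₁ p t = r₁ q t → ∀ v ∈ W₁, r₁ p v = r₁ q v)
    (hdet₂ : ∀ p q, 0 ≤ p → 0 ≤ q → r₂ p t = r₂ q t → ∀ v ∈ W₂, r₂ p v = r₂ q v)
    {n₁ n₂ : ℕ} (h₁ : AffinePieces (fun q (v : {v // v ∈ W₁}) => r₁ q v.val) (n₁ + 1))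
    (h₂ : AffinePieces (fun q (v : {v // v ∈ W₂}) => r₂ q v.val) (n₂ + 1))
    (h0 : r₂ 0 t ≤ r₁ 0 t) : breakpoints F ≤ n₁ + n₂ + 1 := by
  classical
  obtain ⟨g₁, hg₁, hgm₁, haff₁⟩ := exists_index_of_level ht₁ hmono₁ hdet₁ h₁
  obtain ⟨g₂, hg₂, hgm₂, haff₂⟩ := exists_index_of_level ht₂ hmono₂ hdet₂ h₂
  have low : ∀ q, 0 ≤ q → F q t < r₁ 0 t →
      (∀ v ∈ W₁, v ≠ t → F q v = r₁ 0 v) ∧ ∀ v ∈ W₂, F q v = r₂ q v := by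
    intro q hq hlt
    obtain ⟨q₁, q₂, p1, p2, rfl, e1, e2, -, -, e5, e6, e7⟩ := h q hq
    have hne : F (q₁ + q₂) t ≠ r₁ q₁ t := fun e => by linarith [hmono₁ 0 q₁ le_rfl p1]
    obtain rfl : 0 = q₁ := by
      by_contra hq₁
      exact hne (e5 (lt_of_le_of_ne p1 hq₁))
    refine ⟨e1, fun v hv => ?_⟩
    rw [zero_add] at *
    by_cases hvt : v = t
    · subst hvt; exact e7.resolve_left hne
    · exact e2 v hv hvt
  have high : ∀ q, 0 ≤ q → r₁ 0 t ≤ F q t → ∃ q₁ q₂, 0 ≤ q₁ ∧ 0 ≤ q₂ ∧ q = q₁ + q₂ ∧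
      (∀ v ∈ W₁, F q v = r₁ q₁ v) ∧ ∀ v ∈ W₂, F q v = r₂ q₂ v := by
    intro q hq hle
    obtain ⟨q₁, q₂, p1, p2, e0, e1, e2, e3, e4, e5, e6, -⟩ := h q hq
    refine ⟨q₁, q₂, p1, p2, e0, fun v hv => ?_, fun v hv => ?_⟩
    · by_cases hvt : v = t
      · subst hvt
        rcases p1.eq_or_lt with rfl | hpos
        · exact le_antisymm e3 hle
        · exact e5 hpos
      · exact e1 v hv hvt
    · by_cases hvt : v = t
      · subst hvt
        rcases p2.eq_or_lt with rfl | hpos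
        · exact le_antisymm e4 (h0.trans hle)
        · exact e6 hpos
      · exact e2 v hv hvt
  have lev₁ : ∀ q, 0 ≤ q → r₁ 0 t ≤ F q t → ∃ p, 0 ≤ p ∧ F q t = r₁ p t := fun q hq hle => by
    obtain ⟨q₁, q₂, p1, -, -, e, -⟩ := high q hq hle
    exact ⟨q₁, p1, e t ht₁⟩
  have lev₂ : ∀ q, 0 ≤ q → ∃ p, 0 ≤ p ∧ F q t = r₂ p t := fun q hq => by
    rcases lt_or_ge (F q t) (r₁ 0 t) with hlt | hle
    · exact ⟨q, hq, (low q hq hlt).2 t ht₂⟩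
    · obtain ⟨q₁, q₂, -, p2, -, -, e⟩ := high q hq hle
      exact ⟨q₂, p2, e t ht₂⟩
  let a : ℝ → ℕ := fun q => if F q t < r₁ 0 t then 0 else g₁ (F q t)
  let b : ℝ → ℕ := fun q => g₂ (F q t)
  have a_low : ∀ q, F q t < r₁ 0 t → a q = 0 := fun q hlt => if_pos hlt
  have a_high : ∀ q, r₁ 0 t ≤ F q t → a q = g₁ (F q t) := fun q hle => if_neg (not_lt.2 hle)
  have a_pos : ∀ q, 0 ≤ q → r₁ 0 t ≤ F q t → 1 ≤ a q ∧ a q ≤ n₁ + 1 := fun q hq hle => by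
    obtain ⟨p, hp, e⟩ := lev₁ q hq hle
    rw [a_high q hle, e]
    exact hg₁ p hp
  have a_mono : ∀ p q, 0 ≤ p → p ≤ q → a p ≤ a q := fun p q hp hpq => by
    rcases lt_or_ge (F p t) (r₁ 0 t) with hlt | hle
    · rw [a_low p hlt]; exact Nat.zero_le _
    · have hFpq := hF p q hp hpq
      have hle' := hle.trans hFpq
      obtain ⟨y, hy, ey⟩ := lev₁ p hp hle
      obtain ⟨z, hz, ez⟩ := lev₁ q (hp.trans hpq) hle'
      rw [a_high p hle, a_high q hle', ey, ez]
      exact hgm₁ y z hy hz (by rwa [← ey, ← ez])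
  have b_mono : ∀ p q, 0 ≤ p → p ≤ q → b p ≤ b q := fun p q hp hpq => by
    obtain ⟨y, hy, ey⟩ := lev₂ p hp
    obtain ⟨z, hz, ez⟩ := lev₂ q (hp.trans hpq)
    have hFpq := hF p q hp hpq
    change g₂ (F p t) ≤ g₂ (F q t)
    rw [ey, ez] at hFpq ⊢
    exact hgm₂ y z hy hz hFpq
  refine breakpoints_le_of_index (g := fun q => a q + b q) (fun q hq => ?_)
    (fun p q hp hpq => Nat.add_le_add (a_mono p q hp hpq) (b_mono p q hp hpq)) fun k => ?_
  · obtain ⟨p, hp, e⟩ := lev₂ q hq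
    have hb : 1 ≤ b q ∧ b q ≤ n₂ + 1 := by
      change 1 ≤ g₂ (F q t) ∧ g₂ (F q t) ≤ n₂ + 1
      rw [e]; exact hg₂ p hp
    rcases lt_or_ge (F q t) (r₁ 0 t) with hlt | hle
    · have := a_low q hlt
      omega
    · have := a_pos q hq hle
      omega
  by_cases hk : ∃ q, 0 ≤ q ∧ a q + b q = k
  swap
  · exact ⟨0, 0, fun q hq hqk => absurd ⟨q, hq, hqk⟩ hk⟩
  obtain ⟨q₀, hq₀, hk₀⟩ := hk
  have hab : ∀ q, 0 ≤ q → a q + b q = k → a q = a q₀ ∧ b q = b q₀ := fun q hq hqk => by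
    rcases le_total q q₀ with hle | hle
    · have := a_mono q q₀ hq hle
      have := b_mono q q₀ hq hle
      omega
    · have := a_mono q₀ q hq₀ hle
      have := b_mono q₀ q hq₀ hle
      omega
  obtain ⟨c₂, d₂, hc₂, hcd₂⟩ := haff₂ (b q₀)
  rcases lt_or_ge (F q₀ t) (r₁ 0 t) with hlt₀ | hle₀
  · refine ⟨fun v => if v ∈ W₂ then c₂ v else 0, fun v => if v ∈ W₂ then d₂ v else r₁ 0 v,
      fun q hq hqk => ?_⟩
    obtain ⟨ha, hb⟩ := hab q hq hqk
    have hlt : F q t < r₁ 0 t := by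
      by_contra! hle
      have := a_pos q hq hle
      have := a_low q₀ hlt₀
      omega
    obtain ⟨e1, e2⟩ := low q hq hlt
    ext v
    by_cases hv : v ∈ W₂
    · have := hcd₂ q hq (by rw [← e2 t ht₂]; exact hb) v hv
      simp [hv, e2 v hv, this]
    · have hvt : v ≠ t := fun e => hv (e ▸ ht₂)
      simp [hv, e1 v ((hW v).resolve_right hv) hvt]
  · obtain ⟨c₁, d₁, hc₁, hcd₁⟩ := haff₁ (a q₀)
    have main : ∀ q, 0 ≤ q → a q + b q = k → ∃ q₁ q₂, q = q₁ + q₂ ∧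
        (∀ v ∈ W₁, F q v = q₁ * c₁ v + d₁ v) ∧ ∀ v ∈ W₂, F q v = q₂ * c₂ v + d₂ v := by
      intro q hq hqk
      obtain ⟨ha, hb⟩ := hab q hq hqk
      have hle : r₁ 0 t ≤ F q t := by
        by_contra! hlt
        have := a_pos q₀ hq₀ hle₀
        have := a_low q hlt
        omega
      obtain ⟨q₁, q₂, p1, p2, rfl, e1, e2⟩ := high q hq hle
      refine ⟨q₁, q₂, rfl, fun v hv => ?_, fun v hv => ?_⟩
      · rw [e1 v hv]
        exact hcd₁ q₁ p1 (by rw [← e1 t ht₁, ← a_high _ hle]; exact ha) v hv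
      · rw [e2 v hv]
        exact hcd₂ q₂ p2 (by rw [← e2 t ht₂]; exact hb) v hv
    have hsplit : ∃ k₁ e₁ k₂ e₂ : ℝ, ∀ q₁ q₂ : ℝ, q₁ * c₁ t + d₁ t = q₂ * c₂ t + d₂ t →
        (∀ v, q₁ * c₁ v = ((q₁ + q₂) * k₁ + e₁) * c₁ v) ∧
        ∀ v, q₂ * c₂ v = ((q₁ + q₂) * k₂ + e₂) * c₂ v := by
      by_cases hz : c₁ = 0 ∧ c₂ = 0
      · exact ⟨0, 0, 0, 0, fun q₁ q₂ _ => by simp [hz.1, hz.2]⟩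
      · have hne : c₁ t + c₂ t ≠ 0 := by
          rcases hc₁ with hc₁ | hc₁ <;> rcases hc₂ with hc₂ | hc₂
          · positivity
          · simpa [hc₂] using hc₁.ne'
          · simpa [hc₁] using hc₂.ne'
          · exact absurd ⟨hc₁, hc₂⟩ hz
        obtain ⟨k₁, e₁, k₂, e₂, hs⟩ := exists_affine_split hne (d₁ t) (d₂ t)
        refine ⟨k₁, e₁, k₂, e₂, fun q₁ q₂ e => ⟨fun v => ?_, fun v => ?_⟩⟩
        · rw [← (hs q₁ q₂ e).1]
        · rw [← (hs q₁ q₂ e).2]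
    obtain ⟨k₁, e₁, k₂, e₂, hs⟩ := hsplit
    refine ⟨fun v => if v ∈ W₁ then k₁ * c₁ v else k₂ * c₂ v,
      fun v => if v ∈ W₁ then e₁ * c₁ v + d₁ v else e₂ * c₂ v + d₂ v, fun q hq hqk => ?_⟩
    obtain ⟨q₁, q₂, rfl, f1, f2⟩ := main q hq hqk
    obtain ⟨s1, s2⟩ := hs q₁ q₂ ((f1 t ht₁).symm.trans (f2 t ht₂))
    ext v
    by_cases hv : v ∈ W₁
    · simp only [Pi.add_apply, Pi.smul_apply, smul_eq_mul, hv, if_true]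
      rw [f1 v hv, s1 v]
      ring
    · simp only [Pi.add_apply, Pi.smul_apply, smul_eq_mul, hv, if_false]
      rw [f2 v ((hW v).resolve_left hv), s2 v]
      ring

lemma AffinePieces.breakpoints_add_one {E : Type*} [AddCommGroup E] [Module ℝ E] {f : ℝ → E}
    (h : ∃ m, AffinePieces f m) : AffinePieces f (breakpoints f + 1) := by
  obtain ⟨m, hm⟩ := h
  obtain ⟨g, hg, -⟩ := hm.exists_index
  obtain ⟨n, rfl⟩ : ∃ n, m = n + 1 := ⟨m - 1, by have := hg 0 le_rfl; omega⟩
  exact Nat.sInf_mem (s := {n | AffinePieces f (n + 1)}) ⟨n, hm⟩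

/-- Parallel composition: the number of breakpoints of the
label function of `G' = G'[V₁] ∥ G'[V₂]` is at most the sum of the numbers of
breakpoints of the label functions of the parts, plus one. -/
theorem statement18 [DecidableEq V] [Fintype V]
    (Aset Astar : Finset (V × V)) (s t : V) (nu : V × V → ℝ)
    (hAstar : Astar ⊆ Aset) (hnu : ∀ a ∈ Aset, 0 < nu a)
    (htt : TwoTerminal Finset.univ Aset s t)
    (hreach : ∀ v : V, Relation.ReflTransGen (fun u w => (u, w) ∈ Aset) s v)
    (V1 V2 : Finset V) (A1 A2 : Finset (V × V))
    (hA1 : A1 = Aset.filter (fun a => a.1 ∈ V1 ∧ a.2 ∈ V1))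
    (hA2 : A2 = Aset.filter (fun a => a.1 ∈ V2 ∧ a.2 ∈ V2))
    (htt1 : TwoTerminal V1 A1 s t) (htt2 : TwoTerminal V2 A2 s t)
    (hVu : V1 ∪ V2 = Finset.univ) (hVi : V1 ∩ V2 = {s, t})
    (hAu : A1 ∪ A2 = Aset) (hAd : Disjoint A1 A2)
    (rhoG rho1 rho2 : ℝ → V → ℝ)
    (hrhoG : ∀ q : ℝ, 0 ≤ q → ∃ x : V × V → ℝ,
      IsNTFOn Finset.univ Aset Astar nu s t x q (rhoG q) ∧ rhoG q s = 1)
    (hrho1 : ∀ q : ℝ, 0 ≤ q → ∃ x : V × V → ℝ,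
      IsNTFOn V1 A1 (Astar ∩ A1) nu s t x q (rho1 q) ∧ rho1 q s = 1)
    (hrho2 : ∀ q : ℝ, 0 ≤ q → ∃ x : V × V → ℝ,
      IsNTFOn V2 A2 (Astar ∩ A2) nu s t x q (rho2 q) ∧ rho2 q s = 1)
    (hPLG : ∃ m : ℕ, AffinePieces (fun q (v : V) => rhoG q v) m)
    (hPL1 : ∃ m : ℕ, AffinePieces (fun q (v : {v // v ∈ V1}) => rho1 q v.val) m)
    (hPL2 : ∃ m : ℕ, AffinePieces (fun q (v : {v // v ∈ V2}) => rho2 q v.val) m) :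
    breakpoints (fun q (v : V) => rhoG q v) ≤
      breakpoints (fun q (v : {v // v ∈ V1}) => rho1 q v.val) +
      breakpoints (fun q (v : {v // v ∈ V2}) => rho2 q v.val) + 1 := by
  have hst : s ≠ t := by
    rintro rfl
    obtain ⟨x, hx, -⟩ := hrhoG 1 zero_le_one
    have e := hx.1.2.2
    rw [outSum, inSum,
      Finset.filter_eq_empty_iff.2 fun a ha => (htt.2.2.2.2.2 s (Finset.mem_univ _)).2 rfl a ha,
      Finset.filter_eq_empty_iff.2 fun a ha => (htt.2.2.2.2.1 s (Finset.mem_univ _)).2 rfl a ha]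
      at e
    simp at e
  have hsub1 : A1 ⊆ Aset := hAu ▸ Finset.subset_union_left
  have hsub2 : A2 ⊆ Aset := hAu ▸ Finset.subset_union_right
  have hnu1 : ∀ a ∈ A1, 0 < nu a := fun a ha => hnu a (hsub1 ha)
  have hnu2 : ∀ a ∈ A2, 0 < nu a := fun a ha => hnu a (hsub2 ha)
  have hmem : ∀ a ∈ Aset, a ∈ A1 ∨ a ∈ A2 := fun a ha => by
    rwa [← hAu, Finset.mem_union] at ha
  have hinter : ∀ v, v ∈ V1 → v ∈ V2 → v = s ∨ v = t := fun v h1 h2 => by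
    have : v ∈ V1 ∩ V2 := Finset.mem_inter.2 ⟨h1, h2⟩
    simpa [hVi] using this
  have hA1V := htt1.2.2.1
  have hA2V := htt2.2.2.1
  have le1 : ∀ p q, 0 ≤ p → 0 ≤ q → (p ≤ q ∨ rho1 p t ≤ rho1 q t) →
      ∀ v ∈ V1, rho1 p v ≤ rho1 q v := fun p q hp hq hle => by
    obtain ⟨x, hx, hxs⟩ := hrho1 p hp
    obtain ⟨y, hy, hys⟩ := hrho1 q hq
    exact hx.label_le hnu1 htt1 hy (hxs.trans hys.symm) hle
  have le2 : ∀ p q, 0 ≤ p → 0 ≤ q → (p ≤ q ∨ rho2 p t ≤ rho2 q t) →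
      ∀ v ∈ V2, rho2 p v ≤ rho2 q v := fun p q hp hq hle => by
    obtain ⟨x, hx, hxs⟩ := hrho2 p hp
    obtain ⟨y, hy, hys⟩ := hrho2 q hq
    exact hx.label_le hnu2 htt2 hy (hxs.trans hys.symm) hle
  have hF : ∀ p q, 0 ≤ p → p ≤ q → rhoG p t ≤ rhoG q t := fun p q hp hpq => by
    obtain ⟨x, hx, hxs⟩ := hrhoG p hp
    obtain ⟨y, hy, hys⟩ := hrhoG q (hp.trans hpq)
    exact hx.label_le hnu htt hy (hxs.trans hys.symm) (Or.inl hpq) t (Finset.mem_univ _)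
  have hsplit : SplitsInto V1 V2 t rhoG rho1 rho2 := by
    intro q hq
    obtain ⟨x, hx, hxs⟩ := hrhoG q hq
    obtain ⟨a1, a2, a3, a4, a5⟩ := hx.part_labels hnu hst htt1 hsub1
      (fun a ha hv hvs hvt => (hmem a ha).resolve_right fun h2 =>
        (hinter _ hv (hA2V a h2).2).elim hvs hvt)
      (fun a ha hv hvs hvt => (hmem a ha).resolve_right fun h2 =>
        (hinter _ hv (hA2V a h2).1).elim hvs hvt) hrho1 hxs
    obtain ⟨b1, b2, b3, b4, b5⟩ := hx.part_labels hnu hst htt2 hsub2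
      (fun a ha hv hvs hvt => (hmem a ha).resolve_left fun h1 =>
        (hinter _ (hA1V a h1).2 hv).elim hvs hvt)
      (fun a ha hv hvs hvt => (hmem a ha).resolve_left fun h1 =>
        (hinter _ (hA1V a h1).1 hv).elim hvs hvt) hrho2 hxs
    refine ⟨outSum A1 x s, outSum A2 x s, a1, b1, ?_, a2, b2, a3, b3, a4, b4, ?_⟩
    · have e := hx.1.2.2
      rw [inSum, Finset.filter_eq_empty_iff.2
        fun a ha => (htt.2.2.2.2.1 s (Finset.mem_univ _)).2 rfl a ha, Finset.sum_empty,
        sub_zero] at e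
      rw [← e, ← hAu, outSum, Finset.filter_union,
        Finset.sum_union (Finset.disjoint_filter_filter hAd)]
      rfl
    · obtain ⟨a, ha, hat, e⟩ := (hx.2.2.1 t (Finset.mem_univ _) hst.symm).2
      exact (hmem a ha).imp (fun h1 => a5 a h1 hat e) (fun h2 => b5 a h2 hat e)
  have hW : ∀ v, v ∈ V1 ∨ v ∈ V2 := fun v => by
    rw [← Finset.mem_union, hVu]; exact Finset.mem_univ v
  have ht1 := htt1.2.1
  have ht2 := htt2.2.1
  have m1 : ∀ p q, 0 ≤ p → p ≤ q → rho1 p t ≤ rho1 q t := fun p q hp hpq =>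
    le1 p q hp (hp.trans hpq) (Or.inl hpq) t ht1
  have m2 : ∀ p q, 0 ≤ p → p ≤ q → rho2 p t ≤ rho2 q t := fun p q hp hpq =>
    le2 p q hp (hp.trans hpq) (Or.inl hpq) t ht2
  have d1 : ∀ p q, 0 ≤ p → 0 ≤ q → rho1 p t = rho1 q t → ∀ v ∈ V1, rho1 p v = rho1 q v :=
    fun p q hp hq e v hv => le_antisymm (le1 p q hp hq (Or.inr e.le) v hv)
      (le1 q p hq hp (Or.inr e.ge) v hv)
  have d2 : ∀ p q, 0 ≤ p → 0 ≤ q → rho2 p t = rho2 q t → ∀ v ∈ V2, rho2 p v = rho2 q v :=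
    fun p q hp hq e v hv => le_antisymm (le2 p q hp hq (Or.inr e.le) v hv)
      (le2 q p hq hp (Or.inr e.ge) v hv)
  have b1 := AffinePieces.breakpoints_add_one hPL1
  have b2 := AffinePieces.breakpoints_add_one hPL2
  rcases le_total (rho2 0 t) (rho1 0 t) with h0 | h0
  · exact hsplit.breakpoints_le_of_le hW ht1 ht2 hF m1 m2 d1 d2 b1 b2 h0
  · have := hsplit.symm.breakpoints_le_of_le (fun v => (hW v).symm) ht2 ht1 hF m2 m1 d2 d1 b2 b1 h0
    rwa [Nat.add_comm (breakpoints _) (breakpoints _)] at this
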